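/- arXiv:2410.09789 — 2 statements merged into one kernel-verified Lean document; each statement's English description precedes it below -/
import Mathlib

section
/- Let f : (0,∞) → (0,∞) be continuous with ∫₀^{1/2} f(x) dx < ∞, f(x) ≥ 1/(x·(log₂ x)²) for all x ∈ (0,1/2], and f(x) = 2 for all x ∈ (1/2,∞). Define s : ℝ → ℝ by s(x) = ∫₀^x f(|y|) dy. Then s is a strictly increasing continuous bijection from ℝ onto ℝ, s is differentiable at every x ≠ 0 with s'(x) = f(|x|), and the inverse function q = s^{-1} : ℝ → ℝ is differentiable at every point of ℝ, with q'(x) = 1/f(|q(x)|) for x ≠ 0 and q'(0) = 0. -/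
open MeasureTheory Set

open Filter Topology in
theorem Real.tendsto_mul_logb_sq_nhdsGT_zero (b : ℝ) :
    Tendsto (fun t : ℝ => t * (Real.logb b t) ^ 2) (𝓝[>] 0) (𝓝 0) := by
  have h := ((tendsto_log_mul_rpow_nhdsGT_zero (r := 1 / 2) (by norm_num)).pow 2).div_const
    (Real.log b ^ 2)
  have h0 : (0 : ℝ) ^ 2 / Real.log b ^ 2 = 0 := by simp
  rw [h0] at h
  refine h.congr' ?_
  filter_upwards [self_mem_nhdsWithin] with t ht
  have ht' : (0 : ℝ) < t := ht
  rw [mul_pow, ← Real.sqrt_eq_rpow, Real.sq_sqrt ht'.le, Real.logb, div_pow]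
  ring

open Filter Topology in
/-- A function bounded below by `1 / (t * (logb 2 t) ^ 2)` near `0` is eventually larger than any
constant. -/
theorem exists_forall_le_of_inv_mul_logb_sq_le {f : ℝ → ℝ}
    (hf : ∀ x : ℝ, 0 < x → x ≤ 1 / 2 → 1 / (x * (Real.logb 2 x) ^ 2) ≤ f x) {C : ℝ} (hC : 0 < C) :
    ∃ δ > 0, ∀ t, 0 < t → t < δ → C ≤ f t := by
  have h := (Real.tendsto_mul_logb_sq_nhdsGT_zero 2).eventually (gt_mem_nhds (inv_pos.2 hC))
  obtain ⟨u, hu, hu'⟩ := mem_nhdsGT_iff_exists_Ioo_subset.1 h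
  refine ⟨min u (1 / 2), lt_min hu (by norm_num), fun t ht htu => ?_⟩
  have ht2 : t < 1 / 2 := htu.trans_le (min_le_right _ _)
  refine le_trans ?_ (hf t ht ht2.le)
  have h1 : t * (Real.logb 2 t) ^ 2 < C⁻¹ := hu' ⟨ht, htu.trans_le (min_le_left _ _)⟩
  have h2 : 0 < t * (Real.logb 2 t) ^ 2 := by
    have : Real.logb 2 t < 0 := Real.logb_neg (by norm_num) ht (by linarith)
    have := sq_pos_of_neg this
    positivity
  rw [one_div]
  exact (le_inv_comm₀ hC h2).2 h1.le

theorem intervalIntegrable_comp_abs {f : ℝ → ℝ}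
    (hf : ∀ b, 0 ≤ b → IntervalIntegrable f volume 0 b) (a b : ℝ) :
    IntervalIntegrable (fun y => f |y|) volume a b := by
  have hpos : ∀ b, 0 ≤ b → IntervalIntegrable (fun y => f |y|) volume 0 b := fun b hb =>
    (hf b hb).congr fun y hy => by
      rw [uIoc_of_le hb] at hy
      simp [abs_of_pos hy.1]
  have h0 : ∀ b, IntervalIntegrable (fun y => f |y|) volume 0 b := by
    intro b
    rcases le_total 0 b with hb | hb
    · exact hpos b hb
    · simpa using (IntervalIntegrable.iff_comp_neg enorm_ne_top).1 (hpos (-b) (by linarith))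
  exact (h0 a).symm.trans (h0 b)

theorem intervalIntegral_comp_abs_neg (f : ℝ → ℝ) (x : ℝ) :
    ∫ y in (0 : ℝ)..(-x), f |y| = -∫ y in (0 : ℝ)..x, f |y| := by
  have h := intervalIntegral.integral_comp_neg (a := 0) (b := x) (fun y => f |y|)
  simp only [abs_neg, neg_zero] at h
  rw [h, intervalIntegral.integral_symm]

open Filter Topology in
/-- If `s` grows superlinearly fast at `0`, any continuous right inverse vanishing at `0` has
derivative `0` there. -/
theorem hasDerivAt_zero_of_rightInverse {s q : ℝ → ℝ} (hq : ContinuousAt q 0) (hq0 : q 0 = 0)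
    (hsq : Function.RightInverse q s)
    (h : ∀ C : ℝ, 0 < C → ∀ᶠ x in 𝓝 0, C * |x| ≤ |s x|) : HasDerivAt q 0 0 := by
  rw [hasDerivAt_iff_isLittleO]
  simp only [hq0, sub_zero, smul_zero]
  refine Asymptotics.IsLittleO.of_bound fun c hc => ?_
  have hq' : Tendsto q (𝓝 0) (𝓝 0) := by simpa [ContinuousAt, hq0] using hq
  filter_upwards [hq'.eventually (h c⁻¹ (inv_pos.2 hc))] with y hy
  rw [hsq y, inv_mul_le_iff₀ hc] at hy
  simpa using hy

/-- Under the stated hypotheses on `f`, the function `s x = ∫₀ˣ f |y| dy`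
is a strictly increasing continuous bijection of `ℝ`, differentiable with `s' x = f |x|`
for `x ≠ 0`, and its inverse `q` is differentiable everywhere with `q' x = 1 / f |q x|`
for `x ≠ 0` and `q' 0 = 0`. -/
theorem inverse_scale_function_differentiable
    (f : ℝ → ℝ) (hf_cont : ContinuousOn f (Ioi (0 : ℝ)))
    (hf_pos : ∀ x : ℝ, 0 < x → 0 < f x)
    (hf_int : IntegrableOn f (Ioo (0 : ℝ) (1 / 2)) volume)
    (hf_lb : ∀ x : ℝ, 0 < x → x ≤ 1 / 2 → 1 / (x * (Real.logb 2 x) ^ 2) ≤ f x)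
    (hf_two : ∀ x : ℝ, 1 / 2 < x → f x = 2)
    (s : ℝ → ℝ) (hs : ∀ x : ℝ, s x = ∫ y in (0 : ℝ)..x, f |y|) :
    StrictMono s ∧ Continuous s ∧ Function.Bijective s ∧
    (∀ x : ℝ, x ≠ 0 → HasDerivAt s (f |x|) x) ∧
    (∀ q : ℝ → ℝ, Function.LeftInverse q s → Function.RightInverse q s →
      (∀ x : ℝ, x ≠ 0 → HasDerivAt q (1 / f |q x|) x) ∧ HasDerivAt q 0 0) := by
  have hs_eq : s = fun x => ∫ y in (0 : ℝ)..x, f |y| := funext hs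
  have hs0 : s 0 = 0 := by simp [hs]
  have hs_neg : ∀ x, s (-x) = -s x := fun x => by
    rw [hs, hs, intervalIntegral_comp_abs_neg]
  have hint : ∀ a b, IntervalIntegrable (fun y => f |y|) volume a b := by
    have h_half : IntervalIntegrable f volume 0 (1 / 2) :=
      (intervalIntegrable_iff_integrableOn_Ioo_of_le (by norm_num)).2 hf_int
    refine intervalIntegrable_comp_abs fun b hb => ?_
    rcases le_total b (1 / 2) with hb' | hb'
    · exact h_half.mono_set (
        uIcc_subset_uIcc_left (by rw [uIcc_of_le (by norm_num)]; exact ⟨hb, hb'⟩))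
    · refine h_half.trans (ContinuousOn.intervalIntegrable (hf_cont.mono fun x hx => ?_))
      rw [uIcc_of_le hb'] at hx
      exact lt_of_lt_of_le (by norm_num) hx.1
  have hcont : Continuous s := by
    rw [hs_eq]
    exact intervalIntegral.continuous_primitive hint 0
  have hg_cont : ContinuousOn (fun y => f |y|) {0}ᶜ :=
    hf_cont.comp continuous_abs.continuousOn fun y hy => abs_pos.2 hy
  have hderiv : ∀ x : ℝ, x ≠ 0 → HasDerivAt s (f |x|) x := by
    intro x hx
    rw [hs_eq]
    exact intervalIntegral.integral_hasDerivAt_right (hint 0 x)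
      (hg_cont.stronglyMeasurableAtFilter isOpen_compl_singleton x hx)
      (hg_cont.continuousAt (isOpen_compl_singleton.mem_nhds hx))
  have hmono : StrictMono s := by
    refine StrictMonoOn.Iic_union_Ici (a := 0)
      (strictMonoOn_of_deriv_pos (convex_Iic 0) hcont.continuousOn fun x hx => ?_)
      (strictMonoOn_of_deriv_pos (convex_Ici 0) hcont.continuousOn fun x hx => ?_)
    · rw [interior_Iic] at hx
      rw [(hderiv x hx.ne).deriv]
      exact hf_pos _ (abs_pos.2 hx.ne)
    · rw [interior_Ici] at hx
      rw [(hderiv x hx.ne').deriv]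
      exact hf_pos _ (abs_pos.2 hx.ne')
  have htop : Filter.Tendsto s Filter.atTop Filter.atTop := by
    refine Filter.tendsto_atTop_mono' _ (f₁ := fun x => s (1 / 2) + (x - 1 / 2) * 2) ?_ ?_
    · filter_upwards [Filter.eventually_ge_atTop (1 / 2)] with x hx
      have h1 := intervalIntegral.integral_interval_sub_left (hint 0 x) (hint 0 (1 / 2))
      have h2 : ∫ y in (1 / 2 : ℝ)..x, f |y| = ∫ y in (1 / 2 : ℝ)..x, (2 : ℝ) := by
        refine intervalIntegral.integral_congr_ae (Filter.Eventually.of_forall fun y hy => ?_)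
        rw [uIoc_of_le hx] at hy
        rw [abs_of_pos (lt_trans (by norm_num) hy.1), hf_two y hy.1]
      rw [h2, intervalIntegral.integral_const, smul_eq_mul, ← hs, ← hs] at h1
      linarith
    · refine Filter.tendsto_atTop_add_const_left _ _ (
        Filter.Tendsto.atTop_mul_const (by norm_num) ?_)
      simpa [sub_eq_add_neg] using
        Filter.tendsto_atTop_add_const_right Filter.atTop (-(1 / 2) : ℝ) Filter.tendsto_id
  have hbot : Filter.Tendsto s Filter.atBot Filter.atBot := by
    have h := Filter.tendsto_neg_atTop_atBot.comp (htop.comp Filter.tendsto_neg_atBot_atTop)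
    refine h.congr fun x => ?_
    simp [hs_neg]
  refine ⟨hmono, hcont, ⟨hmono.injective, hcont.surjective htop hbot⟩, hderiv,
    fun q hqs hsq => ?_⟩
  have hq_mono : StrictMono q := fun x y hxy => by
    rwa [← hmono.lt_iff_lt, hsq x, hsq y]
  have hq_cont : Continuous q := hq_mono.monotone.continuous_of_surjective hqs.surjective
  have hq0 : q 0 = 0 := by simpa [hs0] using hqs 0
  refine ⟨fun x hx => ?_, hasDerivAt_zero_of_rightInverse hq_cont.continuousAt hq0 hsq
    fun C hC => ?_⟩
  · have hqx : q x ≠ 0 := fun h => hx (by rw [← hsq x, h, hs0])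
    rw [one_div]
    exact (hderiv (q x) hqx).of_local_left_inverse hq_cont.continuousAt
      (hf_pos _ (abs_pos.2 hqx)).ne' (Filter.Eventually.of_forall hsq)
  · obtain ⟨δ, hδ, hδC⟩ := exists_forall_le_of_inv_mul_logb_sq_le hf_lb hC
    have hpos : ∀ x, 0 ≤ x → x < δ → C * x ≤ s x := by
      intro x hx hxδ
      have h := intervalIntegral.integral_mono_on_of_le_Ioo hx
        (intervalIntegrable_const (c := C)) (hint 0 x) fun y hy => by
          rw [abs_of_pos hy.1]
          exact hδC y hy.1 (hy.2.trans hxδ)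
      rw [intervalIntegral.integral_const, smul_eq_mul, ← hs] at h
      linarith
    filter_upwards [Metric.ball_mem_nhds (0 : ℝ) hδ] with x hx
    have hx' : |x| < δ := by simpa using hx
    have h_abs : |s (|x|)| = |s x| := by
      rcases abs_choice x with h | h <;> simp [h, hs_neg]
    rw [← h_abs]
    exact (hpos |x| (abs_nonneg x) hx').trans (le_abs_self _)
end

section
/- Let f : (0,∞) → (0,∞) be a function such that: f is continuous on (0,∞); f(2^{-n}) = n·2^n for every integer n ≥ 1, and f(x) = 2 for all x ∈ (1/2,∞); 1/(x·(log₂ x)²) ≤ f(x) ≤ |log₂ x|/x for every x ∈ (0,1/2] not of the form 2^{-n}; ∫₀^{1/2} f(x) dx < ∞; and for every integer n ≥ 1 there exists c ∈ [2^{-n-1}, 2^{-n}] such that f is nonincreasing on [2^{-n-1}, c] and nondecreasing on [c, 2^{-n}]. Define s : ℝ → ℝ by s(x) = ∫₀^x f(|y|) dy. Then s is a strictly increasing continuous bijection from ℝ onto ℝ, and its inverse q = s^{-1} is a dc function on ℝ: there exist convex functions g, h : ℝ → ℝ with q = g − h. -/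
open MeasureTheory Set

lemma exists_monotone_sub_of_unimodal {v : ℝ → ℝ} (hv : ∀ x, 0 ≤ v x) {a b c : ℝ}
    (hac : a ≤ c) (hcb : c ≤ b) (hmono : MonotoneOn v (Icc a c))
    (hanti : AntitoneOn v (Icc c b)) :
    ∃ P N : ℝ → ℝ, Monotone P ∧ Monotone N ∧ (∀ x, 0 ≤ P x) ∧ (∀ x, 0 ≤ N x) ∧
      (∀ x, P x ≤ v c) ∧ (∀ x, N x ≤ v c) ∧ (∀ x ≤ a, P x = 0) ∧ (∀ x ≤ a, N x = 0) ∧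
      ∀ x, P x - N x = v (min x b) - v (min x a) := by
  have hl : ∀ x, max a (min x c) ∈ Icc a c := fun x =>
    ⟨le_max_left _ _, max_le hac (min_le_right _ _)⟩
  have hr : ∀ x, max c (min x b) ∈ Icc c b := fun x =>
    ⟨le_max_left _ _, max_le hcb (min_le_right _ _)⟩
  refine ⟨fun x => v (max a (min x c)) - v a, fun x => v c - v (max c (min x b)),
    fun x y hxy => ?_, fun x y hxy => ?_, fun x => ?_, fun x => ?_, fun x => ?_, fun x => ?_,
    fun x hx => ?_, fun x hx => ?_, fun x => ?_⟩
  · exact sub_le_sub_right (hmono (hl x) (hl y) (by gcongr)) _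
  · exact sub_le_sub_left (hanti (hr x) (hr y) (by gcongr)) _
  · exact sub_nonneg.2 (hmono (left_mem_Icc.2 hac) (hl x) (hl x).1)
  · exact sub_nonneg.2 (hanti (left_mem_Icc.2 hcb) (hr x) (hr x).1)
  · have := hmono (hl x) (right_mem_Icc.2 hac) (hl x).2
    have := hv a
    dsimp only; linarith
  · have := hv (max c (min x b))
    dsimp only; linarith
  · simp [min_eq_left (hx.trans hac), hx]
  · simp [min_eq_left (hx.trans (hac.trans hcb)), hx.trans hac]
  · dsimp only
    rcases le_total x a with hxa | hxa
    · simp [min_eq_left (hxa.trans (hac.trans hcb)), hxa,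
        hxa.trans hac]
    rcases le_total x c with hxc | hxc
    · simp [hxa, hxc, hxc.trans hcb]
    · simp [hxa, hxc, hac, hcb]

/-- A function that rises and then falls on each of countably many consecutive intervals
shrinking to `0`, with summable peaks, is a difference of monotone functions vanishing on
`(-∞, 0]`. -/
lemma exists_monotone_sub_of_unimodal_pieces {v : ℝ → ℝ} (hv : ∀ x, 0 ≤ v x)
    (hv0 : ∀ x ≤ 0, v x = 0) {t c : ℕ → ℝ} (ht0 : ∀ n, 0 < t n)
    (htlim : Filter.Tendsto t Filter.atTop (nhds 0))
    (hvt : Filter.Tendsto (fun n => v (t n)) Filter.atTop (nhds 0))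
    (hc : ∀ n, c n ∈ Icc (t (n + 1)) (t n))
    (hmono : ∀ n, MonotoneOn v (Icc (t (n + 1)) (c n)))
    (hanti : ∀ n, AntitoneOn v (Icc (c n) (t n)))
    (hsum : Summable fun n => v (c n)) :
    ∃ A B : ℝ → ℝ, Monotone A ∧ Monotone B ∧ (∀ x ≤ 0, A x = 0) ∧ (∀ x ≤ 0, B x = 0) ∧
      ∀ x, v (min x (t 0)) = A x - B x := by
  choose P N hP hN hP0 hN0 hPle hNle hPz hNz hPN using fun n =>
    exists_monotone_sub_of_unimodal hv (hc n).1 (hc n).2 (hmono n) (hanti n)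
  have hsP : ∀ x, Summable fun n => P n x := fun x =>
    hsum.of_nonneg_of_le (fun n => hP0 n x) (fun n => hPle n x)
  have hsN : ∀ x, Summable fun n => N n x := fun x =>
    hsum.of_nonneg_of_le (fun n => hN0 n x) (fun n => hNle n x)
  refine ⟨fun x => ∑' n, P n x, fun x => ∑' n, N n x, fun x y hxy => ?_, fun x y hxy => ?_,
    fun x hx => ?_, fun x hx => ?_, fun x => ?_⟩
  · exact (hsP x).tsum_le_tsum (fun n => hP n hxy) (hsP y)
  · exact (hsN x).tsum_le_tsum (fun n => hN n hxy) (hsN y)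
  · simp [hPz _ x (hx.trans (ht0 _).le)]
  · simp [hNz _ x (hx.trans (ht0 _).le)]
  · have hlim := ((hsP x).hasSum.sub (hsN x).hasSum).tendsto_sum_nat
    have htel : ∀ n, ∑ i ∈ Finset.range n, (P i x - N i x)
        = v (min x (t 0)) - v (min x (t n)) := fun n => by
      simp_rw [hPN]
      exact Finset.sum_range_sub' (fun i => v (min x (t i))) n
    simp_rw [htel] at hlim
    have hz : Filter.Tendsto (fun n => v (min x (t n))) Filter.atTop (nhds 0) := by
      rcases le_or_gt x 0 with hx | hx
      · simp [hv0 _ (min_le_of_left_le hx)]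
      · refine hvt.congr' ?_
        filter_upwards [htlim.eventually_lt_const hx] with n hn
        rw [min_eq_right hn.le]
    have := tendsto_nhds_unique hlim (tendsto_const_nhds.sub hz)
    simpa using this.symm

lemma Monotone.convexOn_integral {a : ℝ → ℝ} (ha : Monotone a) :
    ConvexOn ℝ univ fun x => ∫ t in (0 : ℝ)..x, a t := by
  have hi : ∀ x y, IntervalIntegrable a volume x y := fun x y => ha.intervalIntegrable
  refine convexOn_of_slope_mono_adjacent convex_univ fun {x y z} _ _ hxy hyz => ?_
  rw [intervalIntegral.integral_interval_sub_left (hi _ _) (hi _ _),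
    intervalIntegral.integral_interval_sub_left (hi _ _) (hi _ _)]
  trans a y
  · rw [div_le_iff₀ (sub_pos.2 hxy)]
    have := intervalIntegral.integral_mono_on hxy.le (hi x y) (intervalIntegrable_const (c := a y))
      (fun t ht => ha ht.2)
    simp at this; linarith
  · rw [le_div_iff₀ (sub_pos.2 hyz)]
    have := intervalIntegral.integral_mono_on hyz.le (intervalIntegrable_const (c := a y)) (hi y z)
      (fun t ht => ha ht.1)
    simp at this; linarith

/-- A primitive of a function positive off the origin and constant near infinity. -/
lemma primitive_properties {F s : ℝ → ℝ} (hpos : ∀ x, x ≠ 0 → 0 < F x)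
    (hint : ∀ a b, IntervalIntegrable F volume a b) (hcont : ContinuousOn F {0}ᶜ) {R k : ℝ}
    (hR : 0 < R) (hlarge : ∀ x, R < |x| → F x = k) (hs : ∀ x, s x = ∫ y in (0 : ℝ)..x, F y) :
    StrictMono s ∧ Continuous s ∧ Function.Surjective s ∧
      ∀ x, x ≠ 0 → HasDerivAt s (F x) x := by
  obtain rfl : s = fun x => ∫ y in (0 : ℝ)..x, F y := funext hs
  have hk : 0 < k := by
    rw [← hlarge (R + 1) (by rw [abs_of_pos (by positivity)]; linarith)]
    exact hpos _ (by positivity)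
  have hsub : ∀ x y, (∫ t in (0 : ℝ)..y, F t) - ∫ t in (0 : ℝ)..x, F t = ∫ t in x..y, F t :=
    fun x y => intervalIntegral.integral_interval_sub_left (hint _ _) (hint _ _)
  have hcont_s : Continuous fun x => ∫ y in (0 : ℝ)..x, F y :=
    intervalIntegral.continuous_primitive hint 0
  have hlt : ∀ x y, x < y → (∀ t ∈ Ioo x y, t ≠ 0) →
      (∫ t in (0 : ℝ)..x, F t) < ∫ t in (0 : ℝ)..y, F t := fun x y hxy h0 =>
    sub_pos.1 <| (hsub x y).symm ▸ intervalIntegral.intervalIntegral_pos_of_pos_on (hint x y)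
      (fun t ht => hpos t (h0 t ht)) hxy
  refine ⟨StrictMonoOn.Iic_union_Ici (a := 0)
      (fun x _ y hy hxy => hlt x y hxy fun t ht => (ht.2.trans_le hy).ne)
      (fun x hx y _ hxy => hlt x y hxy fun t ht => (lt_of_le_of_lt hx ht.1).ne'),
    hcont_s, hcont_s.surjective ?_ ?_, fun x hx => ?_⟩
  · have hlin : Filter.Tendsto (fun x => (∫ y in (0 : ℝ)..R, F y) + (x - R) * k)
        Filter.atTop Filter.atTop :=
      Filter.tendsto_atTop_add_const_left _ _
        ((Filter.tendsto_atTop_add_const_right _ (-R) Filter.tendsto_id).atTop_mul_const hk)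
    refine hlin.congr' ?_
    filter_upwards [Filter.eventually_ge_atTop R] with x hx
    have : ∫ t in R..x, F t = ∫ _ in R..x, k :=
      intervalIntegral.integral_congr_ae <| Filter.Eventually.of_forall fun t ht => by
        rw [uIoc_of_le hx] at ht
        exact hlarge t (ht.1.trans_le (le_abs_self t))
    have h := hsub R x
    rw [this, intervalIntegral.integral_const, smul_eq_mul] at h
    linarith
  · have hlin : Filter.Tendsto (fun x => (∫ y in (0 : ℝ)..(-R), F y) + (x + R) * k)
        Filter.atBot Filter.atBot :=
      Filter.tendsto_atBot_add_const_left _ _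
        ((Filter.tendsto_atBot_add_const_right _ R Filter.tendsto_id).atBot_mul_const hk)
    refine hlin.congr' ?_
    filter_upwards [Filter.eventually_le_atBot (-R)] with x hx
    have : ∫ t in x..(-R), F t = ∫ _ in x..(-R), k :=
      intervalIntegral.integral_congr_ae <| by
        filter_upwards [compl_mem_ae_iff.2 (measure_singleton (-R))] with t htR ht
        rw [uIoc_of_le hx] at ht
        have : t < -R := lt_of_le_of_ne ht.2 htR
        exact hlarge t (lt_of_lt_of_le (by linarith) (neg_le_abs t))
    have h := hsub x (-R)
    rw [this, intervalIntegral.integral_const, smul_eq_mul] at h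
    linarith
  · have hx' : ({0}ᶜ : Set ℝ) ∈ nhds x := isOpen_compl_singleton.mem_nhds hx
    exact intervalIntegral.integral_hasDerivAt_right (hint 0 x)
      (hcont.stronglyMeasurableAtFilter isOpen_compl_singleton x hx) (hcont.continuousAt hx')

/-- If the reciprocal derivative of `s` is a difference of monotone functions off the origin,
then the inverse of `s` is a difference of convex functions. -/
lemma exists_convexOn_sub_of_inverse {s q d A B : ℝ → ℝ} (hs : StrictMono s)
    (hl : Function.LeftInverse q s) (hr : Function.RightInverse q s) (hA : Monotone A)
    (hB : Monotone B) (hd : ∀ x, x ≠ 0 → HasDerivAt s (d x) x) (hd0 : ∀ x, x ≠ 0 → d x ≠ 0)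
    (hAB : ∀ x, x ≠ 0 → (d x)⁻¹ = A x - B x) :
    ∃ g h : ℝ → ℝ, ConvexOn ℝ univ g ∧ ConvexOn ℝ univ h ∧ ∀ x, q x = g x - h x := by
  have hq : Monotone q := fun x y hxy => hs.le_iff_le.1 (by rwa [hr x, hr y])
  have hqc : Continuous q := hq.continuous_of_surjective hl.surjective
  have hAi : ∀ x y, IntervalIntegrable (A ∘ q) volume x y := fun x y =>
    (hA.comp hq).intervalIntegrable
  have hBi : ∀ x y, IntervalIntegrable (B ∘ q) volume x y := fun x y =>
    (hB.comp hq).intervalIntegrable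
  refine ⟨fun x => (∫ t in (0 : ℝ)..x, (A ∘ q) t) + q 0, fun x => ∫ t in (0 : ℝ)..x, (B ∘ q) t,
    (hA.comp hq).convexOn_integral.add_const _, (hB.comp hq).convexOn_integral, fun x => ?_⟩
  have hFTC := integral_eq_of_hasDerivAt_off_countable (a := 0) (b := x) (s := {s 0}) q
    (fun t => (A ∘ q) t - (B ∘ q) t) (countable_singleton _) hqc.continuousOn
    (fun t ht => by
      have hqt : q t ≠ 0 := fun h => ht.2 (by rw [← hr t, h]; rfl)
      have := HasDerivAt.of_local_left_inverse hqc.continuousAt (hd _ hqt) (hd0 _ hqt)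
        (Filter.Eventually.of_forall hr)
      rwa [hAB _ hqt] at this)
    ((hAi _ _).sub (hBi _ _))
  rw [intervalIntegral.integral_sub (hAi _ _) (hBi _ _)] at hFTC
  dsimp only
  linarith

lemma one_div_le_of_unimodal_minimum {f : ℝ → ℝ}
    (hf_dyadic : ∀ n : ℕ, 1 ≤ n → f ((2 : ℝ) ^ (-(n : ℤ))) = (n : ℝ) * 2 ^ n)
    (hf_bnd : ∀ x : ℝ, 0 < x → x ≤ 1 / 2 → (∀ n : ℕ, 1 ≤ n → x ≠ (2 : ℝ) ^ (-(n : ℤ))) →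
      1 / (x * (Real.logb 2 x) ^ 2) ≤ f x) {n : ℕ} (hn : 1 ≤ n) {c : ℝ}
    (hc : c ∈ Icc ((2 : ℝ) ^ (-(n : ℤ) - 1)) ((2 : ℝ) ^ (-(n : ℤ)))) :
    1 / f c ≤ ((n : ℝ) + 1) ^ 2 * (1 / 2) ^ n := by
  have hpow : (2 : ℝ) ^ (-(n : ℤ)) = (1 / 2) ^ n := by simp [zpow_neg]
  have hc0 : 0 < c := lt_of_lt_of_le (by positivity) hc.1
  have hcle : c ≤ (1 / 2) ^ n := hpow ▸ hc.2
  have hchalf : c ≤ 1 / 2 := hcle.trans (pow_le_of_le_one (by norm_num) (by norm_num) (by omega))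
  by_cases h : ∃ m : ℕ, 1 ≤ m ∧ c = (2 : ℝ) ^ (-(m : ℤ))
  · obtain ⟨m, hm, rfl⟩ := h
    have hm' : (1 : ℝ) ≤ m := by exact_mod_cast hm
    have h1 : 1 / ((m : ℝ) * 2 ^ m) ≤ (2 : ℝ) ^ (-(m : ℤ)) := by
      rw [zpow_neg, zpow_natCast, ← one_div]
      gcongr
      nlinarith [pow_pos (two_pos : (0 : ℝ) < 2) m]
    have h2 : (1 : ℝ) ≤ ((n : ℝ) + 1) ^ 2 := one_le_pow₀ (by simp)
    rw [hf_dyadic m hm]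
    calc _ ≤ _ := h1.trans hcle
      _ ≤ _ := le_mul_of_one_le_left (by positivity) h2
  · push Not at h
    have hlog0 : Real.logb 2 c < 0 := Real.logb_neg (by norm_num) hc0 (by linarith)
    have hlog : -((n : ℝ) + 1) ≤ Real.logb 2 c := by
      rw [Real.le_logb_iff_rpow_le (by norm_num) hc0]
      refine le_trans (le_of_eq ?_) hc.1
      rw [← Real.rpow_intCast]
      push_cast; ring_nf
    have hsq : Real.logb 2 c ^ 2 ≤ ((n : ℝ) + 1) ^ 2 := by nlinarith
    have hsq0 : 0 < Real.logb 2 c ^ 2 := sq_pos_of_neg hlog0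
    calc 1 / f c ≤ 1 / (1 / (c * Real.logb 2 c ^ 2)) :=
          one_div_le_one_div_of_le (by positivity) (hf_bnd c hc0 hchalf h)
      _ = Real.logb 2 c ^ 2 * c := by rw [one_div_one_div, mul_comm]
      _ ≤ _ := by gcongr

lemma exists_monotone_sub_one_div {f : ℝ → ℝ}
    (hf_pos : ∀ x : ℝ, 0 < x → 0 < f x)
    (hf_dyadic : ∀ n : ℕ, 1 ≤ n → f ((2 : ℝ) ^ (-(n : ℤ))) = (n : ℝ) * 2 ^ n)
    (hf_two : ∀ x : ℝ, 1 / 2 < x → f x = 2)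
    (hf_bnd : ∀ x : ℝ, 0 < x → x ≤ 1 / 2 → (∀ n : ℕ, 1 ≤ n → x ≠ (2 : ℝ) ^ (-(n : ℤ))) →
      1 / (x * (Real.logb 2 x) ^ 2) ≤ f x)
    (hf_uni : ∀ n : ℕ, 1 ≤ n → ∃ c ∈ Icc ((2 : ℝ) ^ (-(n : ℤ) - 1)) ((2 : ℝ) ^ (-(n : ℤ))),
      AntitoneOn f (Icc ((2 : ℝ) ^ (-(n : ℤ) - 1)) c) ∧
      MonotoneOn f (Icc c ((2 : ℝ) ^ (-(n : ℤ))))) :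
    ∃ A B : ℝ → ℝ, Monotone A ∧ Monotone B ∧ ∀ x, x ≠ 0 → (f |x|)⁻¹ = A x - B x := by
  have hhalf : f (1 / 2) = 2 := by simpa using hf_dyadic 1 le_rfl
  set v : ℝ → ℝ := fun x => if x ≤ 0 then 0 else 1 / f x with hv_def
  have hv0 : ∀ x ≤ 0, v x = 0 := fun x hx => if_pos hx
  have hvpos : ∀ x, 0 < x → v x = 1 / f x := fun x hx => if_neg hx.not_ge
  have hv : ∀ x, 0 ≤ v x := fun x => by
    rcases le_or_gt x 0 with hx | hx
    · exact (hv0 x hx).ge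
    · rw [hvpos x hx]; exact (one_div_pos.2 (hf_pos x hx)).le
  choose c hc hanti hmono using fun n : ℕ => hf_uni (n + 1) (Nat.le_add_left 1 n)
  set t : ℕ → ℝ := fun n => (2 : ℝ) ^ (-((n + 1 : ℕ) : ℤ)) with ht_def
  have ht0 : ∀ n, 0 < t n := fun n => by positivity
  have ht_succ : ∀ n, t (n + 1) = (2 : ℝ) ^ (-((n + 1 : ℕ) : ℤ) - 1) := fun n => by
    simp only [ht_def]; push_cast; ring_nf
  simp_rw [← ht_succ] at hc hanti
  have ht_pow : ∀ n, t n = (1 / 2) ^ (n + 1) := fun n => by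
    simp only [ht_def]; rw [zpow_neg, zpow_natCast]; simp
  have htlim : Filter.Tendsto t Filter.atTop (nhds 0) := by
    simp_rw [funext ht_pow]
    exact (tendsto_pow_atTop_nhds_zero_of_lt_one (by norm_num) (by norm_num)).comp
      (Filter.tendsto_add_atTop_nat 1)
  have hvt : Filter.Tendsto (fun n => v (t n)) Filter.atTop (nhds 0) := by
    refine squeeze_zero (fun n => hv _) (fun n => ?_) htlim
    rw [hvpos _ (ht0 n), hf_dyadic (n + 1) (by omega), ht_pow, one_div_pow]
    gcongr
    exact le_mul_of_one_le_left (by positivity) (by simp)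
  have hcpos : ∀ n, 0 < c n := fun n => (ht0 _).trans_le (hc n).1
  have hsum : Summable fun n => v (c n) := by
    have h2 := ((summable_nat_add_iff 2).2
      (summable_pow_mul_geometric_of_norm_lt_one 2 (r := (1 / 2 : ℝ)) (by norm_num))).mul_left 2
    refine h2.of_nonneg_of_le (fun n => hv _) fun n => ?_
    rw [hvpos _ (hcpos n)]
    have := one_div_le_of_unimodal_minimum hf_dyadic hf_bnd (Nat.le_add_left 1 n)
      (ht_succ n ▸ hc n)
    refine this.trans (le_of_eq ?_)
    push_cast; ring
  obtain ⟨A, B, hA, hB, hA0, hB0, hAB⟩ := exists_monotone_sub_of_unimodal_pieces hv hv0 ht0 htlim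
    hvt hc
    (fun n x hx y hy hxy => by
      have hx0 := (ht0 _).trans_le hx.1
      have hy0 := (ht0 _).trans_le hy.1
      rw [hvpos x hx0, hvpos y hy0]
      exact one_div_le_one_div_of_le (hf_pos y hy0) (hanti n hx hy hxy))
    (fun n x hx y hy hxy => by
      have hx0 := (hcpos n).trans_le hx.1
      have hy0 := (hcpos n).trans_le hy.1
      rw [hvpos x hx0, hvpos y hy0]
      exact one_div_le_one_div_of_le (hf_pos x hx0) (hmono n hx hy hxy)) hsum
  have hAB' : ∀ x, 0 < x → (f x)⁻¹ = A x - B x := fun x hx => by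
    rw [← hAB, hvpos _ (lt_min hx (ht0 0)), one_div, ht_pow, zero_add, pow_one]
    rcases le_or_gt x (1 / 2) with h | h
    · rw [min_eq_left h]
    · rw [min_eq_right h.le, hhalf, hf_two x h]
  refine ⟨fun x => A x - B (-x), fun x => B x - A (-x),
    fun x y hxy => sub_le_sub (hA hxy) (hB (neg_le_neg hxy)),
    fun x y hxy => sub_le_sub (hB hxy) (hA (neg_le_neg hxy)), fun x hx => ?_⟩
  dsimp only
  rcases hx.lt_or_gt with h | h
  · rw [abs_of_neg h, hAB' _ (neg_pos.2 h), hA0 x h.le, hB0 x h.le]; ring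
  · rw [abs_of_pos h, hAB' _ h, hA0 (-x) (by linarith), hB0 (-x) (by linarith)]; ring

lemma intervalIntegrable_comp_abs_s8 {f : ℝ → ℝ} {R k : ℝ} (hR : 0 < R)
    (hf_int : IntegrableOn f (Ioo 0 R) volume) (hf_const : ∀ x, R < x → f x = k) (a b : ℝ) :
    IntervalIntegrable (fun y => f |y|) volume a b := by
  refine intervalIntegrable_of_even (fun x => by rw [abs_neg]) fun x hx => ?_
  have h1 : IntegrableOn f (Ioc 0 R) := (integrableOn_Ioc_iff_integrableOn_Ioo).2 hf_int
  have h2 : IntegrableOn f (Ioc R (max R x)) :=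
    (integrableOn_const (C := k) (by simp)).congr_fun (fun t ht => (hf_const t ht.1).symm)
      measurableSet_Ioc
  have h3 : IntegrableOn f (Ioc 0 x) := by
    refine (h1.union h2).mono_set ?_
    rw [Ioc_union_Ioc_eq_Ioc hR.le (le_max_left _ _)]
    exact Ioc_subset_Ioc_right (le_max_right _ _)
  rw [intervalIntegrable_iff_integrableOn_Ioc_of_le hx.le]
  exact h3.congr_fun (fun t ht => by simp only [abs_of_pos ht.1]) measurableSet_Ioc

/-- For the function `f` of the counterexample (continuous, `f (2⁻ⁿ) = n·2ⁿ`,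
`f = 2` on `(1/2,∞)`, two-sided logarithmic bounds at non-dyadic points of `(0,1/2]`,
integrable near `0`, and unimodal on each dyadic interval), the scale function
`s x = ∫₀ˣ f |y| dy` is a strictly increasing continuous bijection of `ℝ`, and its
inverse `q = s⁻¹` is a dc function on `ℝ`. -/
theorem inverse_scale_function_is_dc
    (f : ℝ → ℝ) (hf_cont : ContinuousOn f (Ioi (0 : ℝ)))
    (hf_pos : ∀ x : ℝ, 0 < x → 0 < f x)
    (hf_dyadic : ∀ n : ℕ, 1 ≤ n → f ((2 : ℝ) ^ (-(n : ℤ))) = (n : ℝ) * 2 ^ n)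
    (hf_two : ∀ x : ℝ, 1 / 2 < x → f x = 2)
    (hf_bnd : ∀ x : ℝ, 0 < x → x ≤ 1 / 2 → (∀ n : ℕ, 1 ≤ n → x ≠ (2 : ℝ) ^ (-(n : ℤ))) →
      1 / (x * (Real.logb 2 x) ^ 2) ≤ f x ∧ f x ≤ |Real.logb 2 x| / x)
    (hf_int : IntegrableOn f (Ioo (0 : ℝ) (1 / 2)) volume)
    (hf_uni : ∀ n : ℕ, 1 ≤ n → ∃ c ∈ Icc ((2 : ℝ) ^ (-(n : ℤ) - 1)) ((2 : ℝ) ^ (-(n : ℤ))),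
      AntitoneOn f (Icc ((2 : ℝ) ^ (-(n : ℤ) - 1)) c) ∧
      MonotoneOn f (Icc c ((2 : ℝ) ^ (-(n : ℤ)))))
    (s : ℝ → ℝ) (hs : ∀ x : ℝ, s x = ∫ y in (0 : ℝ)..x, f |y|) :
    StrictMono s ∧ Continuous s ∧ Function.Bijective s ∧
    (∀ q : ℝ → ℝ, Function.LeftInverse q s → Function.RightInverse q s →
      ∃ g h : ℝ → ℝ, ConvexOn ℝ univ g ∧ ConvexOn ℝ univ h ∧ ∀ x : ℝ, q x = g x - h x) := by
  have habs : ∀ x : ℝ, x ≠ 0 → 0 < f |x| := fun x hx => hf_pos _ (abs_pos.2 hx)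
  obtain ⟨hmono, hcont, hsurj, hderiv⟩ := primitive_properties habs
    (intervalIntegrable_comp_abs_s8 one_half_pos hf_int hf_two)
    (hf_cont.comp continuous_abs.continuousOn fun x hx => abs_pos.2 hx) one_half_pos
    (fun x hx => hf_two _ hx) hs
  obtain ⟨A, B, hA, hB, hAB⟩ := exists_monotone_sub_one_div hf_pos hf_dyadic hf_two
    (fun x hx hx' hn => (hf_bnd x hx hx' hn).1) hf_uni
  exact ⟨hmono, hcont, ⟨hmono.injective, hsurj⟩, fun q hl hr =>
    exists_convexOn_sub_of_inverse hmono hl hr hA hB hderiv (fun x hx => (habs x hx).ne') hAB⟩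
end
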